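/- arXiv:0903.1554 — 2 statements merged into one kernel-verified Lean document; each statement's English description precedes it below -/
import Mathlib

section
/- Let A = A^D be the planar forest algebra and consider the complex whose n-th term is A^{⊗n} (n ≥ 1) with differential d''(v_1 ⊗ … ⊗ v_n) = Σ_{i=1}^{n−1} (−1)^{i−1} v_1 ⊗ … ⊗ v_{i−1} ⊗ (v_i ↗ v_{i+1}) ⊗ v_{i+2} ⊗ … ⊗ v_n, where ↗ is the left grafting on the leftmost leaf. Then for every n ≥ 2, Ker(d'' : A^{⊗n} → A^{⊗(n−1)}) = Im(d'' : A^{⊗(n+1)} → A^{⊗n}); that is, the shifted Hochschild homology of the associative algebra (A, ↗) is concentrated in degree 1. -/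
noncomputable section

/-- A planar rooted tree decorated by `D`: a root decorated by an element of `D` together
with a (possibly empty) ordered list of planar subtrees. -/
inductive PTree (D : Type) : Type
  | node : D → List (PTree D) → PTree D

/-- A nonempty planar forest decorated by `D`: a nonempty ordered list of `D`-decorated
planar rooted trees, given by its first tree and the list of the remaining ones. -/
structure PForest (D : Type) : Type where
  head : PTree D
  tail : List (PTree D)

namespace PForest

variable {D : Type}

/-- The underlying list of trees of a forest. -/
def toList (F : PForest D) : List (PTree D) := F.head :: F.tail

/-- Concatenation `F · G` of two forests. -/
def concat (F G : PForest D) : PForest D := ⟨F.head, F.tail ++ G.toList⟩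

/-- Left grafting on the root: for `G = B_d(t₁ … t_m) G'`,
`F ↘ G = B_d(F t₁ … t_m) G'`. -/
def graftRoot (F G : PForest D) : PForest D :=
  match G with
  | ⟨.node d ts, G'⟩ => ⟨.node d (F.toList ++ ts), G'⟩

/-- Left grafting of a forest on the leftmost leaf of a tree. -/
def graftLeafT (L : List (PTree D)) : PTree D → PTree D
  | .node d [] => .node d L
  | .node d (h :: hs) => .node d (graftLeafT L h :: hs)

/-- Left grafting on the leftmost leaf: for `G = B_d(H) G'`, `F ↗ G = B_d(F) G'` if `H`
is empty, and `F ↗ G = B_d(F ↗ H) G'` otherwise. -/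
def graftLeaf (F G : PForest D) : PForest D := ⟨graftLeafT F.toList G.head, G.tail⟩

/-- The single-vertex tree `•_d`, as a forest. -/
def vertex (d : D) : PForest D := ⟨.node d [], []⟩

end PForest

variable (K : Type*) [Field K] (D : Type)

/-- The planar forest algebra `A^D`: the vector space with basis the set of nonempty
`D`-decorated planar forests. -/
abbrev FA : Type _ := PForest D →₀ K

/-- The bilinear extension to `A^D` of a binary operation on forests. -/
def bil (op : PForest D → PForest D → PForest D) : FA K D →ₗ[K] FA K D →ₗ[K] FA K D :=
  Finsupp.lsum K fun F =>
    LinearMap.toSpanSingleton K (FA K D →ₗ[K] FA K D)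
      (Finsupp.lsum K fun G =>
        LinearMap.toSpanSingleton K (FA K D) (Finsupp.single (op F G) (1 : K)))
/-- Merge the entries in (0-indexed) positions `p` and `p+1` of a list by means of the
binary operation `op` (leaving the list unchanged if `p+1` is out of range). -/
def mergeAt {α : Type*} (op : α → α → α) : ℕ → List α → List α
  | 0, x :: y :: rest => op x y :: rest
  | n + 1, x :: rest => x :: mergeAt op n rest
  | _, l => l

/-- The Hochschild-type differential `d'` on words on the forest algebra, associated with
the binary operation `op` on forests:
`d'(v₁ ⊗ … ⊗ vₙ) = Σ_{i=1}^{n-1} (-1)^{i-1} v₁ ⊗ … ⊗ (vᵢ op vᵢ₊₁) ⊗ … ⊗ vₙ`. -/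
def dW (op : PForest D → PForest D → PForest D) :
    (List (PForest D) →₀ K) →ₗ[K] (List (PForest D) →₀ K) :=
  Finsupp.lsum K fun l =>
    LinearMap.toSpanSingleton K (List (PForest D) →₀ K)
      (∑ p ∈ Finset.range (l.length - 1),
        ((-1 : K) ^ p) • Finsupp.single (mergeAt op p l) (1 : K))
/-- Sends a word `y :: r` to `op x y :: r`, and the empty word to `0`. -/
def mulHead (op : PForest D → PForest D → PForest D) (x : PForest D) :
    (List (PForest D) →₀ K) →ₗ[K] (List (PForest D) →₀ K) :=
  Finsupp.lsum K fun l =>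
    LinearMap.toSpanSingleton K (List (PForest D) →₀ K)
      (match l with
        | [] => 0
        | y :: r => Finsupp.single (op x y :: r) 1)

/-- Prepends the letter `x` to words. -/
def consWord (x : PForest D) : (List (PForest D) →₀ K) →ₗ[K] (List (PForest D) →₀ K) :=
  Finsupp.lmapDomain K K (List.cons x)

/-- Replaces the first letter `x` of a word by the two letters of `s x`; words on which this is
impossible are sent to `0`. -/
def splitHead (s : PForest D → Option (PForest D × PForest D)) :
    (List (PForest D) →₀ K) →ₗ[K] (List (PForest D) →₀ K) :=
  Finsupp.lsum K fun l =>
    LinearMap.toSpanSingleton K (List (PForest D) →₀ K)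
      (match l with
        | [] => 0
        | x :: r =>
          match s x with
          | none => 0
          | some (a, b) => Finsupp.single (a :: b :: r) 1)

section Words

variable {K D}
variable (op : PForest D → PForest D → PForest D)

lemma dW_single (l : List (PForest D)) :
    dW K D op (Finsupp.single l 1) =
      ∑ p ∈ Finset.range (l.length - 1), ((-1 : K) ^ p) • Finsupp.single (mergeAt op p l) 1 := by
  simp [dW]

@[simp] lemma dW_single_nil : dW K D op (Finsupp.single [] 1) = 0 := by
  simp [dW_single]

@[simp] lemma consWord_single (x : PForest D) (l : List (PForest D)) (c : K) :
    consWord K D x (Finsupp.single l c) = Finsupp.single (x :: l) c := by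
  simp [consWord]

@[simp] lemma mulHead_single_nil (x : PForest D) :
    mulHead K D op x (Finsupp.single [] 1) = 0 := by
  simp [mulHead]

@[simp] lemma mulHead_single_cons (x y : PForest D) (r : List (PForest D)) :
    mulHead K D op x (Finsupp.single (y :: r) 1) = Finsupp.single (op x y :: r) 1 := by
  simp [mulHead]

lemma dW_consWord (x : PForest D) (u : List (PForest D) →₀ K) :
    dW K D op (consWord K D x u) = mulHead K D op x u - consWord K D x (dW K D op u) := by
  have h : dW K D op ∘ₗ consWord K D x = mulHead K D op x - consWord K D x ∘ₗ dW K D op := by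
    ext1 l
    apply LinearMap.ext_ring
    rcases l with _ | ⟨y, r⟩
    · simp [dW_single]
    · simp only [LinearMap.comp_apply, LinearMap.sub_apply, Finsupp.lsingle_apply,
        consWord_single, mulHead_single_cons, dW_single, List.length_cons, Nat.add_sub_cancel,
        map_sum, map_smul]
      rw [Finset.sum_range_succ', sub_eq_add_neg, add_comm, ← Finset.sum_neg_distrib]
      simp [mergeAt, pow_succ]
  exact LinearMap.congr_fun h u

lemma dW_single_cons (x : PForest D) (l : List (PForest D)) :
    dW K D op (Finsupp.single (x :: l) 1) =
      mulHead K D op x (Finsupp.single l 1) -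
        consWord K D x (dW K D op (Finsupp.single l 1)) := by
  rw [← dW_consWord, consWord_single]

lemma mulHead_consWord (x y : PForest D) (u : List (PForest D) →₀ K) :
    mulHead K D op x (consWord K D y u) = consWord K D (op x y) u := by
  have h : mulHead K D op x ∘ₗ consWord K D y = consWord K D (op x y) := by
    ext1 l
    apply LinearMap.ext_ring
    simp
  exact LinearMap.congr_fun h u

lemma mulHead_mulHead (assoc : ∀ x y z, op (op x y) z = op x (op y z)) (x y : PForest D)
    (u : List (PForest D) →₀ K) :
    mulHead K D op x (mulHead K D op y u) = mulHead K D op (op x y) u := by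
  have h : mulHead K D op x ∘ₗ mulHead K D op y = mulHead K D op (op x y) := by
    ext1 l
    apply LinearMap.ext_ring
    rcases l with _ | ⟨z, r⟩ <;> simp [assoc]
  exact LinearMap.congr_fun h u

lemma dW_mulHead (assoc : ∀ x y z, op (op x y) z = op x (op y z)) (x : PForest D)
    (u : List (PForest D) →₀ K) :
    dW K D op (mulHead K D op x u) = mulHead K D op x (dW K D op u) := by
  have h : dW K D op ∘ₗ mulHead K D op x = mulHead K D op x ∘ₗ dW K D op := by
    ext1 l
    apply LinearMap.ext_ring
    rcases l with _ | ⟨y, r⟩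
    · simp
    · simp [dW_single_cons, mulHead_mulHead op assoc, mulHead_consWord]
  exact LinearMap.congr_fun h u

theorem dW_dW (assoc : ∀ x y z, op (op x y) z = op x (op y z))
    (u : List (PForest D) →₀ K) : dW K D op (dW K D op u) = 0 := by
  have h : dW K D op ∘ₗ dW K D op = 0 := by
    ext1 l
    apply LinearMap.ext_ring
    simp only [LinearMap.comp_apply, Finsupp.lsingle_apply, LinearMap.zero_apply]
    induction l with
    | nil => simp
    | cons x l ih => simp [dW_single_cons, dW_mulHead op assoc, dW_consWord, ih]
  exact LinearMap.congr_fun h u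

lemma length_mergeAt {α : Type*} (f : α → α → α) (p : ℕ) (l : List α) (h : p + 1 < l.length) :
    (mergeAt f p l).length = l.length - 1 := by
  induction p generalizing l with
  | zero =>
    match l, h with
    | x :: y :: r, _ => simp [mergeAt]
  | succ p ih =>
    match l, h with
    | x :: r, h =>
      have := ih r (by simpa using h)
      simp only [List.length_cons] at h
      simp only [mergeAt, List.length_cons, this]
      omega

lemma dW_mem_supported {n : ℕ} {u : List (PForest D) →₀ K}
    (hu : u ∈ Finsupp.supported K K {l : List (PForest D) | l.length = n + 1}) :
    dW K D op u ∈ Finsupp.supported K K {l : List (PForest D) | l.length = n} := by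
  rw [Finsupp.supported_eq_span_single] at hu
  induction hu using Submodule.span_induction with
  | mem v hv =>
    obtain ⟨l, hl, rfl⟩ := hv
    rw [dW_single]
    refine Submodule.sum_mem _ fun p hp => Submodule.smul_mem _ _ ?_
    refine Finsupp.single_mem_supported K _ ?_
    rw [Finset.mem_range] at hp
    have hl' : l.length = n + 1 := hl
    rw [Set.mem_ofPred_eq, length_mergeAt op p l (by omega), hl', Nat.add_sub_cancel]
  | zero => simp
  | add v w _ _ hv hw => rw [map_add]; exact add_mem hv hw
  | smul c v _ hv => rw [map_smul]; exact Submodule.smul_mem _ c hv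

variable (s : PForest D → Option (PForest D × PForest D))

lemma splitHead_mem_supported {n : ℕ} {u : List (PForest D) →₀ K}
    (hu : u ∈ Finsupp.supported K K {l : List (PForest D) | l.length = n}) :
    splitHead K D s u ∈ Finsupp.supported K K {l : List (PForest D) | l.length = n + 1} := by
  rw [Finsupp.supported_eq_span_single] at hu
  induction hu using Submodule.span_induction with
  | mem v hv =>
    obtain ⟨l, rfl, rfl⟩ := hv
    rcases l with _ | ⟨x, r⟩
    · simp [splitHead]
    · rcases hx : s x with _ | ⟨a, b⟩
      · simp [splitHead, hx]
      · simpa [splitHead, hx] using Finsupp.single_mem_supported K (1 : K) (by simp)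
  | zero => simp
  | add v w _ _ hv hw => rw [map_add]; exact add_mem hv hw
  | smul c v _ hv => rw [map_smul]; exact Submodule.smul_mem _ c hv

variable {s}

lemma splitHead_consWord_of_none {x : PForest D} (hx : s x = none)
    (u : List (PForest D) →₀ K) : splitHead K D s (consWord K D x u) = 0 := by
  have h : splitHead K D s ∘ₗ consWord K D x = 0 := by
    ext1 l
    apply LinearMap.ext_ring
    simp [splitHead, hx]
  exact LinearMap.congr_fun h u

lemma splitHead_consWord_of_some {x a b : PForest D} (hx : s x = some (a, b))
    (u : List (PForest D) →₀ K) :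
    splitHead K D s (consWord K D x u) = consWord K D a (consWord K D b u) := by
  have h : splitHead K D s ∘ₗ consWord K D x = consWord K D a ∘ₗ consWord K D b := by
    ext1 l
    apply LinearMap.ext_ring
    simp [splitHead, hx]
  exact LinearMap.congr_fun h u

lemma dW_splitHead_add_single
    (op_eq : ∀ x a b, s x = some (a, b) → op a b = x)
    (split_none : ∀ x y, s x = none → s (op x y) = some (x, y))
    (split_some : ∀ x y a b, s x = some (a, b) → s (op x y) = some (a, op b y))
    (x y : PForest D) (r : List (PForest D)) :
    dW K D op (splitHead K D s (Finsupp.single (x :: y :: r) 1)) +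
        splitHead K D s (dW K D op (Finsupp.single (x :: y :: r) 1)) =
      Finsupp.single (x :: y :: r) 1 := by
  rw [dW_single_cons op x, mulHead_single_cons, map_sub, ← consWord_single x,
    ← consWord_single (op x y)]
  rcases hx : s x with _ | ⟨a, b⟩
  · rw [splitHead_consWord_of_none hx, splitHead_consWord_of_none hx,
      splitHead_consWord_of_some (split_none x y hx)]
    simp
  · rw [splitHead_consWord_of_some hx, splitHead_consWord_of_some hx,
      splitHead_consWord_of_some (split_some x y a b hx), dW_consWord, mulHead_consWord,
      op_eq x a b hx, dW_consWord]
    simp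

/-- Splitting the first letter is a contracting homotopy in degrees at least two. -/
theorem dW_splitHead_add
    (op_eq : ∀ x a b, s x = some (a, b) → op a b = x)
    (split_none : ∀ x y, s x = none → s (op x y) = some (x, y))
    (split_some : ∀ x y a b, s x = some (a, b) → s (op x y) = some (a, op b y))
    {n : ℕ} (hn : 2 ≤ n) {u : List (PForest D) →₀ K}
    (hu : u ∈ Finsupp.supported K K {l : List (PForest D) | l.length = n}) :
    dW K D op (splitHead K D s u) + splitHead K D s (dW K D op u) = u := by
  rw [Finsupp.supported_eq_span_single] at hu
  induction hu using Submodule.span_induction with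
  | mem v hv =>
    obtain ⟨l, rfl, rfl⟩ := hv
    match l, hn with
    | x :: y :: r, _ => exact dW_splitHead_add_single op op_eq split_none split_some x y r
  | zero => simp
  | add v w _ _ hv hw =>
    simp only [map_add]
    rw [add_add_add_comm, hv, hw]
  | smul c v _ hv => simp only [map_smul, ← smul_add, hv]

end Words

namespace PForest

variable {D}

/-- Splits off the first factor of the forest with first tree `t` and remaining trees `tl` in the
free semigroup of forests under `↗`: the forest whose first vertex is the leftmost leaf. -/
def splitLeafT : PTree D → List (PTree D) → Option (PForest D × PForest D)
  | .node _ [], _ => none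
  | .node d (h :: hs), tl =>
    match splitLeafT h hs with
    | none => some (⟨h, hs⟩, ⟨.node d [], tl⟩)
    | some (a, b) => some (a, ⟨.node d b.toList, tl⟩)

/-- The factorization of a forest as `a ↗ b` with `a` indecomposable, if there is one. -/
def splitLeaf (F : PForest D) : Option (PForest D × PForest D) :=
  splitLeafT F.head F.tail

lemma graftLeafT_graftLeafT (L : List (PTree D)) (t : PTree D) (ts : List (PTree D)) :
    ∀ u : PTree D, graftLeafT (graftLeafT L t :: ts) u = graftLeafT L (graftLeafT (t :: ts) u)
  | .node d [] => by simp [graftLeafT]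
  | .node d (h :: hs) => by simp [graftLeafT, graftLeafT_graftLeafT L t ts h]

lemma graftLeaf_assoc (F G H : PForest D) :
    graftLeaf (graftLeaf F G) H = graftLeaf F (graftLeaf G H) := by
  simp [graftLeaf, toList, graftLeafT_graftLeafT]

lemma graftLeaf_of_splitLeafT :
    ∀ (t : PTree D) (tl : List (PTree D)) (a b : PForest D),
      splitLeafT t tl = some (a, b) → graftLeaf a b = ⟨t, tl⟩
  | .node d [], tl, a, b, hs => by simp [splitLeafT] at hs
  | .node d (h :: hs), tl, a, b, hab => by
    rcases e : splitLeafT h hs with _ | ⟨a', b'⟩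
    · simp only [splitLeafT, e, Option.some.injEq, Prod.mk.injEq] at hab
      obtain ⟨rfl, rfl⟩ := hab
      simp [graftLeaf, graftLeafT, toList]
    · simp only [splitLeafT, e, Option.some.injEq, Prod.mk.injEq] at hab
      obtain ⟨rfl, rfl⟩ := hab
      have ih := graftLeaf_of_splitLeafT h hs a' b' e
      simp only [graftLeaf, PForest.mk.injEq] at ih
      simp [graftLeaf, graftLeafT, toList, ← ih.1, ← ih.2]

lemma splitLeafT_graftLeafT_of_none (F : PForest D) (hF : splitLeaf F = none) :
    ∀ (t : PTree D) (tl : List (PTree D)),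
      splitLeafT (graftLeafT F.toList t) tl = some (F, ⟨t, tl⟩)
  | .node d [], tl => by
    rw [splitLeaf] at hF
    simp [graftLeafT, splitLeafT, toList, hF]
  | .node d (h :: hs), tl => by
    simp only [graftLeafT, splitLeafT, splitLeafT_graftLeafT_of_none F hF h hs]
    simp [toList]

lemma splitLeafT_graftLeafT_of_some (F a b : PForest D) (hF : splitLeaf F = some (a, b)) :
    ∀ (t : PTree D) (tl : List (PTree D)),
      splitLeafT (graftLeafT F.toList t) tl = some (a, ⟨graftLeafT b.toList t, tl⟩)
  | .node d [], tl => by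
    rw [splitLeaf] at hF
    simp [graftLeafT, splitLeafT, toList, hF]
  | .node d (h :: hs), tl => by
    simp only [graftLeafT, splitLeafT, splitLeafT_graftLeafT_of_some F a b hF h hs]
    simp [toList]

end PForest

/-- Let `A = A^D` be the planar forest algebra and consider the complex
whose `n`-th term is `A^{⊗n}` (with basis the words of `n` forests) with the Hochschild
differential `d''` associated with the left grafting `↗` on the leftmost leaf.  Then for
every `n ≥ 2`, `Ker(d'' : A^{⊗n} → A^{⊗(n-1)}) = Im(d'' : A^{⊗(n+1)} → A^{⊗n})`: the
shifted Hochschild homology of the associative algebra `(A, ↗)` is concentrated in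
degree `1`. -/
theorem hochschild_graftLeaf_exact [Fintype D] :
    ∀ n : ℕ, 2 ≤ n →
      LinearMap.ker (dW K D PForest.graftLeaf) ⊓
          Finsupp.supported K K {l : List (PForest D) | l.length = n} =
        Submodule.map (dW K D PForest.graftLeaf)
          (Finsupp.supported K K {l : List (PForest D) | l.length = n + 1}) := by
  intro n hn
  refine le_antisymm ?_ ?_
  · rintro u ⟨hu, hsupp⟩
    refine ⟨splitHead K D PForest.splitLeaf u, splitHead_mem_supported _ hsupp, ?_⟩
    have h := dW_splitHead_add (s := PForest.splitLeaf) PForest.graftLeaf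
      (fun x a b hx => PForest.graftLeaf_of_splitLeafT x.head x.tail a b hx)
      (fun x y hx => PForest.splitLeafT_graftLeafT_of_none x hx y.head y.tail)
      (fun x y a b hx => PForest.splitLeafT_graftLeafT_of_some x a b hx y.head y.tail)
      hn hsupp
    rwa [LinearMap.mem_ker.mp hu, map_zero, add_zero] at h
  · rintro _ ⟨u, hu, rfl⟩
    exact ⟨dW_dW _ PForest.graftLeaf_assoc u, dW_mem_supported _ hu⟩
end
end

section
/- Let A = A^D be the planar forest algebra with the two bilinear operations a·b (concatenation) and a ↘ b (left grafting on the root), and let (C_*, d) be the associated complex. For n ≥ 1 and 1 ≤ k ≤ n, let C_n^k denote the k-th summand A^{⊗n} of C_n (elements pointed in position k) and C_n^{≤k} = ⊕_{i=1}^{k} C_n^i. Then for every n ≥ 2 and every 1 ≤ k ≤ n−1, one has Ker(d) ∩ C_n^{≤k} ⊆ d(C_{n+1}). -/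
noncomputable section

variable (K : Type*) [Field K] (D : Type)

/-- The underlying space of the complex `C_*` associated with the planar forest algebra:
basis the pointed words `(l, j)`, `l` a word of forests and `j` the (0-indexed) position
of the pointed letter (so that the `k`-th summand of `C_n = ⊕_{k=1}^n A^{⊗n}`,
`1 ≤ k ≤ n`, consists of the pairs `(l, j)` with `l.length = n` and `j = k - 1`). -/
abbrev CC : Type _ := (List (PForest D) × ℕ) →₀ K

/-- The differential of the complex `C_*` computing the homology of the `P_↘`-algebra
`A^D`: on a pointed word, the alternating sum of the merges of adjacent letters, the
pointed letter being merged with its left neighbour by `↘` and all other pairs by the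
concatenation product, the point staying on the merged letter. -/
def dCdown : CC K D →ₗ[K] CC K D :=
  Finsupp.lsum K fun q =>
    LinearMap.toSpanSingleton K (CC K D)
      (∑ p ∈ Finset.range (q.1.length - 1),
        ((-1 : K) ^ p) •
          Finsupp.single
            (mergeAt (if p + 1 = q.2 then PForest.graftRoot else PForest.concat) p q.1,
              if p < q.2 then q.2 - 1 else q.2)
            (1 : K))

/-- The differential of the complex `C_*` computing the homology of the `P_↗`-algebra
`A^D`: on a word whose first `j` tensor signs are marked, the alternating sum of the
merges of adjacent letters, the pairs joined by a marked sign being merged by `↗` and all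
other pairs by the concatenation product, the number of marked signs decreasing by one in
the first case. -/
def dCup : CC K D →ₗ[K] CC K D :=
  Finsupp.lsum K fun q =>
    LinearMap.toSpanSingleton K (CC K D)
      (∑ p ∈ Finset.range (q.1.length - 1),
        ((-1 : K) ^ p) •
          Finsupp.single
            (mergeAt (if p < q.2 then PForest.graftLeaf else PForest.concat) p q.1,
              if p < q.2 then q.2 - 1 else q.2)
            (1 : K))
namespace PForest

variable {D : Type}

/-- Split the forest in position `j` of a word into its first tree and the remaining forest,
provided the latter is nonempty. -/
def splitWord : ℕ → List (PForest D) → Option (List (PForest D))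
  | 0, ⟨t, g :: gs⟩ :: r => some (⟨t, []⟩ :: ⟨g, gs⟩ :: r)
  | n + 1, x :: r => (splitWord n r).map (x :: ·)
  | _, _ => none

theorem splitWord_length {j : ℕ} {l l' : List (PForest D)} (h : splitWord j l = some l') :
    l'.length = l.length + 1 := by
  induction j generalizing l l' with
  | zero =>
    rcases l with _ | ⟨⟨t, _ | ⟨g, gs⟩⟩, r⟩ <;> simp [splitWord] at h
    simp [← h]
  | succ n ih =>
    rcases l with _ | ⟨x, r⟩
    · simp [splitWord] at h
    · simp only [splitWord, Option.map_eq_some_iff] at h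
      obtain ⟨m, hm, rfl⟩ := h
      simp [ih hm]

/-- Merging to the left of the pointed letter commutes with splitting that letter. -/
theorem splitWord_mergeAt_left {p j : ℕ} {l : List (PForest D)} (h : p ≤ j)
    (hl : j + 1 < l.length) :
    splitWord j (mergeAt (if p = j then graftRoot else concat) p l) =
      (splitWord (j + 1) l).map (mergeAt (if p = j then graftRoot else concat) p) := by
  induction p generalizing j l with
  | zero =>
    rcases l with _ | ⟨x, _ | ⟨⟨⟨d, ts⟩, G⟩, r⟩⟩
    · simp at hl
    · simp at hl
    · rcases j with _ | j
      · rcases G with _ | ⟨g, gs⟩ <;> simp [mergeAt, splitWord, graftRoot]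
      · simp only [mergeAt, splitWord, Option.map_map]
        rfl
  | succ n ih =>
    rcases j with _ | j
    · omega
    rcases l with _ | ⟨x, r⟩
    · simp at hl
    · simp only [List.length_cons] at hl
      have := ih (j := j) (l := r) (by omega) (by omega)
      simp only [Nat.add_right_cancel_iff, mergeAt, splitWord, this, Option.map_map]
      rfl

/-- Merging to the right of the pointed letter commutes with splitting that letter, up to a
shift, when that letter is not a tree. -/
theorem splitWord_mergeAt_right {p j : ℕ} {l l' : List (PForest D)} (h : j ≤ p)
    (hl : p + 1 < l.length) (hs : splitWord j l = some l') :
    splitWord j (mergeAt concat p l) = some (mergeAt concat (p + 1) l') := by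
  induction j generalizing p l l' with
  | zero =>
    rcases l with _ | ⟨⟨t, _ | ⟨g, gs⟩⟩, r⟩ <;> simp [splitWord] at hs
    subst hs
    rcases p with _ | p
    · rcases r with _ | ⟨y, r⟩
      · simp at hl
      · simp [mergeAt, splitWord, concat]
    · simp [mergeAt, splitWord]
  | succ n ih =>
    rcases p with _ | p
    · omega
    rcases l with _ | ⟨x, r⟩
    · simp at hl
    · simp only [splitWord, Option.map_eq_some_iff] at hs
      obtain ⟨m, hm, rfl⟩ := hs
      simp only [List.length_cons] at hl
      simp [mergeAt, splitWord, ih (p := p) (by omega) (by omega) hm]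

theorem splitWord_mergeAt_of_none {p j : ℕ} {l : List (PForest D)} (h : j < p)
    (hs : splitWord j l = none) : splitWord j (mergeAt concat p l) = none := by
  induction j generalizing p l with
  | zero =>
    rcases p with _ | p
    · omega
    rcases l with _ | ⟨⟨t, _ | ⟨g, gs⟩⟩, r⟩ <;> simp_all [splitWord, mergeAt]
  | succ n ih =>
    rcases p with _ | p
    · omega
    rcases l with _ | ⟨x, r⟩
    · simp [mergeAt, splitWord]
    · simp only [splitWord, Option.map_eq_none_iff] at hs
      simp [mergeAt, splitWord, ih (p := p) (by omega) hs]

/-- If the pointed letter is a tree, splitting undoes its merging with its right neighbour. -/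
theorem splitWord_mergeAt_self_of_none {j : ℕ} {l : List (PForest D)}
    (hl : j + 1 < l.length) (hs : splitWord j l = none) :
    splitWord j (mergeAt concat j l) = some l := by
  induction j generalizing l with
  | zero =>
    rcases l with _ | ⟨⟨t, _ | ⟨g, gs⟩⟩, _ | ⟨y, r⟩⟩ <;>
      simp_all [splitWord, mergeAt, concat, toList]
  | succ n ih =>
    rcases l with _ | ⟨x, r⟩
    · simp at hl
    · simp only [splitWord, Option.map_eq_none_iff] at hs
      simp only [List.length_cons] at hl
      simp [mergeAt, splitWord, ih (by omega) hs]

/-- Merging the two pieces of the pointed letter undoes the splitting. -/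
theorem mergeAt_splitWord {j : ℕ} {l l' : List (PForest D)} (hs : splitWord j l = some l') :
    mergeAt concat j l' = l := by
  induction j generalizing l l' with
  | zero =>
    rcases l with _ | ⟨⟨t, _ | ⟨g, gs⟩⟩, r⟩ <;> simp [splitWord] at hs
    subst hs
    simp [mergeAt, concat, toList]
  | succ n ih =>
    rcases l with _ | ⟨x, r⟩
    · simp [splitWord] at hs
    · simp only [splitWord, Option.map_eq_some_iff] at hs
      obtain ⟨m, hm, rfl⟩ := hs
      simp [mergeAt, ih hm]

end PForest

open PForest

/-- The contracting homotopy on a pointed word: up to a sign, the pointed letter is split into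
its first tree, which becomes the pointed letter, and the remaining forest. -/
def splitTerm (l : List (PForest D)) (j : ℕ) : CC K D :=
  (splitWord j l).elim 0 fun l' => Finsupp.single (l', j) ((-1 : K) ^ j)

/-- The linear extension of `splitTerm` to the complex `C_*`. -/
def splitHomotopy : CC K D →ₗ[K] CC K D :=
  Finsupp.lsum K fun q => LinearMap.toSpanSingleton K (CC K D) (splitTerm K D q.1 q.2)

theorem splitHomotopy_single (l : List (PForest D)) (j : ℕ) (c : K) :
    splitHomotopy K D (Finsupp.single (l, j) c) = c • splitTerm K D l j := by
  simp [splitHomotopy]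

theorem dCdown_single (l : List (PForest D)) (j : ℕ) (c : K) :
    dCdown K D (Finsupp.single (l, j) c) =
      c • ∑ p ∈ Finset.range (l.length - 1), ((-1 : K) ^ p) •
          Finsupp.single
            (mergeAt (if p + 1 = j then PForest.graftRoot else PForest.concat) p l,
              if p < j then j - 1 else j) (1 : K) := by
  simp [dCdown]

/-- `splitHomotopy` is a contracting homotopy on the words whose point is not in last
position. -/
theorem dCdown_splitHomotopy_add_single {l : List (PForest D)} {j : ℕ}
    (hl : j + 1 < l.length) :
    dCdown K D (splitHomotopy K D (Finsupp.single (l, j) 1)) +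
      splitHomotopy K D (dCdown K D (Finsupp.single (l, j) 1)) = Finsupp.single (l, j) 1 := by
  obtain ⟨r, hr⟩ : ∃ r, l.length - 1 = j + (r + 1) := ⟨l.length - 2 - j, by omega⟩
  have hsq : (-1 : K) ^ j * (-1) ^ j = 1 := by rw [← mul_pow]; simp
  simp only [splitHomotopy_single, dCdown_single, map_smul, map_sum, one_smul, hr]
  rw [Finset.sum_range_add]
  have left : ∀ p ∈ Finset.range j,
      splitTerm K D (mergeAt (if p + 1 = j then graftRoot else concat) p l)
        (if p < j then j - 1 else j) =
      -((splitWord j l).elim 0 fun l' => Finsupp.single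
        (mergeAt (if p + 1 = j then graftRoot else concat) p l', j - 1) ((-1 : K) ^ j)) := by
    intro p hp
    rw [Finset.mem_range] at hp
    obtain ⟨i, rfl⟩ : ∃ i, j = i + 1 := ⟨j - 1, by omega⟩
    have := splitWord_mergeAt_left (p := p) (j := i) (l := l) (by omega) (by omega)
    simp only [Nat.add_right_cancel_iff, if_pos hp, Nat.add_sub_cancel, splitTerm, this]
    cases splitWord (i + 1) l <;> simp [pow_succ]
  rw [Finset.sum_congr rfl fun p hp => by rw [left p hp]]
  rcases hs : splitWord j l with _ | l'
  · rw [Finset.sum_range_succ']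
    have right : ∀ p ∈ Finset.range r, splitTerm K D
        (mergeAt (if j + (p + 1) + 1 = j then graftRoot else concat) (j + (p + 1)) l)
        (if j + (p + 1) < j then j - 1 else j) = 0 := by
      intro p _
      rw [if_neg (by omega), if_neg (by omega), splitTerm,
        splitWord_mergeAt_of_none (by omega) hs]
      rfl
    rw [Finset.sum_congr (s₁ := Finset.range r) rfl fun p hp => by rw [right p hp]]
    simp [splitTerm, hs, splitWord_mergeAt_self_of_none hl hs, hsq]
  · have right : ∀ p ∈ Finset.range (r + 1), splitTerm K D
        (mergeAt (if j + p + 1 = j then graftRoot else concat) (j + p) l)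
        (if j + p < j then j - 1 else j) =
        Finsupp.single (mergeAt concat (j + (p + 1)) l', j) ((-1 : K) ^ j) := by
      intro p hp
      rw [Finset.mem_range] at hp
      rw [if_neg (by omega), if_neg (by omega), splitTerm,
        splitWord_mergeAt_right (by omega) (by omega) hs]
      rfl
    rw [Finset.sum_congr (s₁ := Finset.range (r + 1)) rfl fun p hp => by rw [right p hp]]
    have hl' : l'.length - 1 = j + (r + 1 + 1) := by rw [splitWord_length hs]; omega
    simp only [splitTerm, hs, Option.elim_some, dCdown_single, hl']
    rw [Finset.sum_range_add, Finset.sum_range_succ']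
    have left' : ∀ p ∈ Finset.range j, (if p < j then j - 1 else j) = j - 1 :=
      fun p hp => if_pos (Finset.mem_range.mp hp)
    rw [Finset.sum_congr rfl fun p hp => by rw [left' p hp]]
    have e₁ : ∀ p, (if j + p + 1 = j then graftRoot (D := D) else concat) = concat :=
      fun p => if_neg (by omega)
    have e₀ : (if j + 1 = j then graftRoot (D := D) else concat) = concat := if_neg (by omega)
    have e₂ : ∀ p, (if j + p < j then j - 1 else j) = j := fun p => if_neg (by omega)
    simp only [e₁, e₂]
    simp only [add_zero, e₀, mergeAt_splitWord hs, smul_add, Finset.smul_sum,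
      Finsupp.smul_single, smul_eq_mul, mul_one, hsq, smul_neg, Finset.sum_neg_distrib]
    have e₃ : ∀ p, (-1 : K) ^ j * (-1) ^ (j + (p + 1)) = -((-1) ^ (j + p) * (-1) ^ j) := by
      intro p; ring
    simp only [e₃, mul_comm ((-1 : K) ^ j), Finsupp.single_neg, Finset.sum_neg_distrib]
    abel

theorem dCdown_splitHomotopy_add {n : ℕ} {x : CC K D}
    (hx : x ∈ Finsupp.supported K K
      {q : List (PForest D) × ℕ | q.1.length = n ∧ q.2 + 1 < n}) :
    dCdown K D (splitHomotopy K D x) + splitHomotopy K D (dCdown K D x) = x := by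
  rw [Finsupp.supported_eq_span_single] at hx
  induction hx using Submodule.span_induction with
  | mem y hy =>
    obtain ⟨⟨l, j⟩, ⟨h₁, h₂⟩, rfl⟩ := hy
    exact dCdown_splitHomotopy_add_single K D (h₁ ▸ h₂)
  | zero => simp
  | add y z _ _ hy hz =>
    conv_rhs => rw [← hy, ← hz]
    simp only [map_add]
    abel
  | smul c y _ hy =>
    conv_rhs => rw [← hy]
    simp only [map_smul, smul_add]

theorem splitHomotopy_mem_supported {n k : ℕ} {x : CC K D}
    (hx : x ∈ Finsupp.supported K K
      {q : List (PForest D) × ℕ | q.1.length = n ∧ q.2 < k}) :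
    splitHomotopy K D x ∈ Finsupp.supported K K
      {q : List (PForest D) × ℕ | q.1.length = n + 1 ∧ q.2 < k} := by
  rw [Finsupp.supported_eq_span_single] at hx
  induction hx using Submodule.span_induction with
  | mem y hy =>
    obtain ⟨⟨l, j⟩, ⟨h₁, h₂⟩, rfl⟩ := hy
    simp only [splitHomotopy_single, one_smul, splitTerm]
    rcases hs : splitWord j l with _ | l'
    · exact Submodule.zero_mem _
    · exact Finsupp.single_mem_supported K _ ⟨by rw [splitWord_length hs, h₁], h₂⟩
  | zero => simp
  | add y z _ _ hy hz => rw [map_add]; exact Submodule.add_mem _ hy hz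
  | smul c y _ hy => rw [map_smul]; exact Submodule.smul_mem _ c hy

/-- Let `A = A^D` be the planar forest algebra with concatenation and
left grafting `↘` on the root, and `(C_*, d)` the associated complex.  For `n ≥ 2` and
`1 ≤ k ≤ n - 1`, every element of `C_n^{≤ k}` (combination of pointed words of length `n`
whose point lies in one of the first `k` positions) killed by `d` lies in `d(C_{n+1})`. -/
theorem ker_inter_le_k_sub_image_down [Fintype D] :
    ∀ n : ℕ, 2 ≤ n → ∀ k : ℕ, 1 ≤ k → k ≤ n - 1 →
      LinearMap.ker (dCdown K D) ⊓
          Finsupp.supported K K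
            {q : List (PForest D) × ℕ | q.1.length = n ∧ q.2 < k} ≤
        Submodule.map (dCdown K D)
          (Finsupp.supported K K
            {q : List (PForest D) × ℕ | q.1.length = n + 1 ∧ q.2 < n + 1}) := by
  rintro n - k - hk x ⟨hd, hx⟩
  refine ⟨splitHomotopy K D x, Finsupp.supported_mono ?_ (splitHomotopy_mem_supported K D hx), ?_⟩
  · rintro q ⟨h₁, h₂⟩
    exact ⟨h₁, by omega⟩
  · have h := dCdown_splitHomotopy_add K D (n := n) (x := x) <| by
      refine Finsupp.supported_mono ?_ hx
      rintro q ⟨h₁, h₂⟩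
      exact ⟨h₁, by omega⟩
    rwa [LinearMap.mem_ker.mp hd, map_zero, add_zero] at h
end
end
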